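/- Let N≥2 and 1<q≤1*=N/(N−1). Let {u_k}⊂BV̇(R^N) satisfy sup_k ‖u_k‖_{L^∞} < ∞, sup_k ‖u_k‖_{L^1} < ∞ and sup_k ‖Du_k‖ < ∞, and suppose that for every sequence {y_k}⊂R^N one has ∫_{(0,1)^N} |u_k(x−y_k)| dx → 0 (equivalently, sup_{y∈Z^N} ∫_{y+(0,1)^N} |u_k| dx → 0). Then ‖u_k‖_{L^{1*,q}(R^N)} → 0. -/

import Mathlib

open MeasureTheory Set Filter Topology ENNReal

noncomputable section

abbrev Euc (N : ℕ) := EuclideanSpace ℝ (Fin N)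

/-- Decreasing rearrangement of `u` with respect to Lebesgue measure on `ℝ^N`. -/
def rearr (N : ℕ) (u : Euc N → ℝ) (t : ℝ) : ℝ :=
  sInf {l : ℝ | 0 < l ∧ volume {x : Euc N | l < |u x|} ≤ ENNReal.ofReal t}

/-- Lorentz quasinorm `‖u‖_{L^{p,q}}` on `ℝ^N` (with `q = ∞` allowed). -/
def lorentz (N : ℕ) (p : ℝ) (q : ℝ≥0∞) (u : Euc N → ℝ) : ℝ≥0∞ :=
  if q = ∞ then ⨆ t ∈ Ioi (0:ℝ), ENNReal.ofReal (t ^ (1/p) * rearr N u t)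
  else (∫⁻ t in Ioi (0:ℝ),
      ENNReal.ofReal ((t ^ (1/p) * rearr N u t) ^ q.toReal / t)) ^ (1 / q.toReal)

/-- Divergence of a vector field on `ℝ^N`. -/
def divg (N : ℕ) (v : Euc N → Euc N) (x : Euc N) : ℝ :=
  ∑ i : Fin N, fderiv ℝ v x (EuclideanSpace.single i 1) i

/-- Total variation `‖Du‖_Ω` of `u` over a set `Ω`. -/
def TV (N : ℕ) (u : Euc N → ℝ) (Ω : Set (Euc N)) : ℝ≥0∞ :=
  ⨆ (v : Euc N → Euc N) (_ : ContDiff ℝ (⊤ : ℕ∞) v) (_ : HasCompactSupport v)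
    (_ : ∀ x, ‖v x‖ ≤ 1) (_ : tsupport v ⊆ Ω),
    ENNReal.ofReal (∫ x, u x * divg N v x)

/-- `u` vanishes at infinity. -/
def VanishAtInfinity (N : ℕ) (u : Euc N → ℝ) : Prop :=
  ∀ M : ℝ, 0 < M → volume {x : Euc N | M < |u x|} < ∞

/-- Membership in `BV̇(ℝ^N)`. -/
def MemBVdot (N : ℕ) (u : Euc N → ℝ) : Prop :=
  Measurable u ∧ VanishAtInfinity N u ∧ TV N u univ < ∞

/-- The rescaling `g[j,y]u = 2^{(N-1)j} u (2^j (· - y))`. -/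
def resc (N : ℕ) (j : ℤ) (y : Euc N) (u : Euc N → ℝ) : Euc N → ℝ :=
  fun x => (2:ℝ) ^ (((N:ℤ) - 1) * j) * u ((2:ℝ) ^ j • (x - y))

/-- Weak convergence `u k ⇀ w` in `BV̇(ℝ^N)`. -/
def WeakBVconv (N : ℕ) (u : ℕ → Euc N → ℝ) (w : Euc N → ℝ) : Prop :=
  (∀ K : Set (Euc N), IsCompact K →
      Tendsto (fun k => ∫ x in K, |u k x - w x|) atTop (𝓝 0)) ∧
  ∀ i : Fin N, ∀ f : Euc N → ℝ, ContDiff ℝ (⊤ : ℕ∞) f → HasCompactSupport f →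
      Tendsto (fun k => ∫ x, u k x * fderiv ℝ f x (EuclideanSpace.single i 1)) atTop
        (𝓝 (∫ x, w x * fderiv ℝ f x (EuclideanSpace.single i 1)))

/-- The open unit cube `(0,1)^N`. -/
def unitCube (N : ℕ) : Set (Euc N) := {x : Euc N | ∀ i : Fin N, x i ∈ Ioo (0:ℝ) 1}

/-- `L^1` norms are controlled by testing against smooth functions bounded by one. -/
lemma integral_abs_le_of_forall_smooth {N : ℕ} {f : Euc N → ℝ} (hf : Integrable f) {C : ℝ}
    (h : ∀ φ : Euc N → ℝ, ContDiff ℝ (⊤ : ℕ∞) φ → HasCompactSupport φ → (∀ x, |φ x| ≤ 1) →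
      ∫ x, f x * φ x ≤ C) :
    ∫ x, |f x| ≤ C := by
  refine le_of_forall_pos_le_add fun η hη => ?_
  obtain ⟨g, hgc, hgs, hg⟩ := (memLp_one_iff_integrable.2 hf).exist_eLpNorm_sub_le
    one_ne_top le_rfl (ε := η / 3) (by positivity)
  have hgi : Integrable g := hgs.continuous.integrable_of_hasCompactSupport hgc
  have hfg : ∫ x, |f x - g x| ≤ η / 3 := by
    rw [eLpNorm_one_eq_lintegral_enorm] at hg
    have := integral_norm_eq_lintegral_enorm (hf.sub hgi).aestronglyMeasurable
    simp only [Real.norm_eq_abs, Pi.sub_apply] at this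
    rw [this]
    exact ENNReal.toReal_le_of_le_ofReal (by positivity) hg
  set V : ℝ := volume.real (tsupport g) with hV
  have hV0 : 0 ≤ V := measureReal_nonneg
  set δ : ℝ := η / 3 / (V + 1) with hδ
  have hδ0 : 0 < δ := by positivity
  have hδV : δ * V ≤ η / 3 := by
    rw [hδ, div_mul_eq_mul_div, div_le_iff₀ (by positivity)]
    nlinarith
  set s : Euc N → ℝ := fun x => √(g x ^ 2 + δ ^ 2) with hs
  have hs0 : ∀ x, 0 < s x := fun x => Real.sqrt_pos.2 (by positivity)
  have hgs_le : ∀ x, |g x| ≤ s x := fun x => Real.abs_le_sqrt (by nlinarith)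
  have hδs_le : ∀ x, δ ≤ s x := fun x => Real.le_sqrt_of_sq_le (by nlinarith [sq_nonneg (g x)])
  have hs_le : ∀ x, s x ≤ |g x| + δ := fun x => by
    refine Real.sqrt_le_iff.2 ⟨by positivity, ?_⟩
    nlinarith [sq_abs (g x), abs_nonneg (g x)]
  set φ : Euc N → ℝ := fun x => g x * (s x)⁻¹ with hφ
  have hss : ContDiff ℝ (⊤ : ℕ∞) s :=
    ((hgs.pow 2).add contDiff_const).sqrt (fun x => by positivity)
  have hφs : ContDiff ℝ (⊤ : ℕ∞) φ := hgs.mul (hss.inv fun x => (hs0 x).ne')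
  have hφc : HasCompactSupport φ := hgc.mul_right
  have hφ1 : ∀ x, |φ x| ≤ 1 := fun x => by
    rw [hφ, abs_mul, abs_inv, abs_of_pos (hs0 x), ← div_eq_mul_inv, div_le_one (hs0 x)]
    exact hgs_le x
  have hfφ : Integrable fun x => f x * φ x :=
    hf.mul_bdd (c := 1) hφs.continuous.aestronglyMeasurable (ae_of_all _ fun x => hφ1 x)
  have hind : Integrable ((tsupport g).indicator fun _ => δ) :=
    (integrable_indicator_iff hgc.measurableSet).2
      (integrableOn_const hgc.measure_lt_top.ne)
  have hpt : ∀ x, |f x| ≤ f x * φ x + 2 * |f x - g x| + (tsupport g).indicator (fun _ => δ) x := by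
    intro x
    have h1 : |f x| ≤ |g x| + |f x - g x| := by
      have := abs_add_le (g x) (f x - g x)
      simpa using this
    have h2 : |g x| ≤ g x * φ x + (tsupport g).indicator (fun _ => δ) x := by
      by_cases hx : x ∈ tsupport g
      · rw [indicator_of_mem hx, hφ]
        have : g x * (g x * (s x)⁻¹) = |g x| ^ 2 / s x := by rw [sq_abs]; ring
        simp only [this]
        rw [← sub_le_iff_le_add, le_div_iff₀ (hs0 x)]
        nlinarith [hs_le x, hδs_le x, abs_nonneg (g x), hgs_le x]
      · simp [image_eq_zero_of_notMem_tsupport hx, indicator_of_notMem hx]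
    have h3 : g x * φ x ≤ f x * φ x + |f x - g x| := by
      have : (g x - f x) * φ x ≤ |f x - g x| := by
        refine (le_abs_self _).trans ?_
        rw [abs_mul, abs_sub_comm]
        exact mul_le_of_le_one_right (abs_nonneg _) (hφ1 x)
      linarith
    linarith
  have hd : Integrable fun x => 2 * |f x - g x| := ((hf.sub hgi).abs).const_mul 2
  calc ∫ x, |f x|
      ≤ ∫ x, (f x * φ x + 2 * |f x - g x| + (tsupport g).indicator (fun _ => δ) x) :=
        integral_mono hf.abs ((hfφ.add hd).add hind) hpt
    _ = (∫ x, f x * φ x) + 2 * (∫ x, |f x - g x|) + δ * V := by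
        rw [integral_add (f := fun x => f x * φ x + 2 * |f x - g x|) (hfφ.add hd) hind,
          integral_add hfφ hd, integral_const_mul,
          integral_indicator hgc.measurableSet]
        simp [hV, mul_comm]
    _ ≤ C + η := by linarith [h φ hφs hφc hφ1]

/-- Directional derivatives of test functions are controlled by the total variation. -/
lemma integral_mul_fderiv_le_of_TV_le {N : ℕ} {u : Euc N → ℝ} {C : ℝ} (hC : 0 ≤ C)
    (hTV : TV N u univ ≤ ENNReal.ofReal C) {ψ : Euc N → ℝ} (hψs : ContDiff ℝ (⊤ : ℕ∞) ψ)
    (hψc : HasCompactSupport ψ) (hψ1 : ∀ x, |ψ x| ≤ 1) {e : Euc N} (he : ‖e‖ = 1) :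
    ∫ x, u x * fderiv ℝ ψ x e ≤ C := by
  set v : Euc N → Euc N := fun x => ψ x • e with hv
  have hdiv : ∀ x, divg N v x = fderiv ℝ ψ x e := by
    intro x
    have hd : HasFDerivAt v ((fderiv ℝ ψ x).smulRight e) x :=
      ((hψs.differentiable (by simp)) x).hasFDerivAt.smul_const e
    have he' : e = ∑ i, e i • EuclideanSpace.single i (1 : ℝ) := by
      ext j
      simp [Finset.sum_apply, Pi.single_apply]
    rw [divg, hd.fderiv]
    conv_rhs => rw [he', map_sum]
    simp [mul_comm]
  have hle : ENNReal.ofReal (∫ x, u x * divg N v x) ≤ TV N u univ := by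
    refine le_iSup_of_le v <| le_iSup_of_le (hψs.smul contDiff_const) <|
      le_iSup_of_le hψc.smul_right <| le_iSup_of_le (fun x => ?_) <|
      le_iSup_of_le (subset_univ _) le_rfl
    simpa [hv, norm_smul, he] using hψ1 x
  simp only [hdiv] at hle
  exact (ENNReal.ofReal_le_ofReal_iff hC).1 (hle.trans hTV)

/-- The `L^1` modulus of continuity of a function of bounded variation is linear. -/
lemma integral_abs_translate_sub_le {N : ℕ} {u : Euc N → ℝ} (hu : Integrable u) {C : ℝ}
    (hC : 0 ≤ C) (hTV : TV N u univ ≤ ENNReal.ofReal C) (h : Euc N) :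
    ∫ x, |u (x + h) - u x| ≤ C * ‖h‖ := by
  refine integral_abs_le_of_forall_smooth ((hu.comp_add_right h).sub hu) fun φ hφs hφc hφ1 => ?_
  set ψ : Euc N → ℝ := fun x => φ (-x) with hψ
  have hψs : ContDiff ℝ (⊤ : ℕ∞) ψ := hφs.comp contDiff_neg
  have hψc : HasCompactSupport ψ := hφc.comp_homeomorph (Homeomorph.neg _)
  let L := ContinuousLinearMap.mul ℝ ℝ
  have hder := fun x => hψc.hasFDerivAt_convolution_right L hu.locallyIntegrable
    (hψs.of_le (by simp)) x
  have hbd : ∀ x, ‖(MeasureTheory.convolution u (fderiv ℝ ψ) (L.precompR (Euc N)) volume) x‖ ≤ C := by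
    intro x
    refine ContinuousLinearMap.opNorm_le_of_unit_norm hC fun e he => ?_
    rw [convolution_precompR_apply L hu.locallyIntegrable (hψc.fderiv ℝ)
      (hψs.continuous_fderiv (by simp)), convolution_def]
    set θ : Euc N → ℝ := fun t => ψ (x - t) with hθ
    have hθs : ContDiff ℝ (⊤ : ℕ∞) θ := hψs.comp (contDiff_const.sub contDiff_id)
    have hθc : HasCompactSupport θ := hψc.comp_homeomorph (Homeomorph.subLeft x)
    have hθ1 : ∀ t, |θ t| ≤ 1 := fun t => hφ1 _
    have hθd : ∀ t w, fderiv ℝ ψ (x - t) w = fderiv ℝ θ t (-w) := by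
      intro t w
      have h1 : HasFDerivAt θ ((fderiv ℝ ψ (x - t)).comp (-ContinuousLinearMap.id ℝ (Euc N))) t :=
        ((hψs.differentiable (by simp)) (x - t)).hasFDerivAt.comp t
          ((hasFDerivAt_id t).const_sub x)
      rw [h1.fderiv]
      simp
    have h1 := integral_mul_fderiv_le_of_TV_le hC hTV hθs hθc hθ1 he
    have h2 := integral_mul_fderiv_le_of_TV_le hC hTV hθs hθc hθ1 (e := -e) (by simpa)
    simp only [L, ContinuousLinearMap.mul_apply', hθd, Real.norm_eq_abs]
    rw [abs_le]
    refine ⟨?_, h2⟩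
    simp only [map_neg, mul_neg, integral_neg]
    linarith
  have hmv := convex_univ.norm_image_sub_le_of_norm_hasFDerivWithin_le
    (fun x _ => (hder x).hasFDerivWithinAt) (fun x _ => hbd x) (mem_univ 0) (mem_univ h)
  simp only [convolution_def, L, ContinuousLinearMap.mul_apply', sub_zero, hψ, neg_sub] at hmv
  have hint : ∀ {f : Euc N → ℝ}, Integrable f → Integrable fun x => f x * φ x := fun hf =>
    hf.mul_bdd (c := 1) hφs.continuous.aestronglyMeasurable (ae_of_all _ fun x => hφ1 x)
  have key : ∫ x, u (x + h) * φ x = ∫ x, u x * φ (x - h) := by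
    rw [← integral_sub_right_eq_self (fun x => u (x + h) * φ x) h]
    simp
  simp only [Pi.sub_apply, sub_mul]
  rw [integral_sub (hint (hu.comp_add_right h)) (hint hu), key]
  exact (le_abs_self _).trans hmv

lemma isOpen_unitCube (N : ℕ) : IsOpen (unitCube N) := by
  have : unitCube N = ⋂ i : Fin N, {x : Euc N | x i ∈ Ioo (0 : ℝ) 1} := by
    ext x
    simp [unitCube]
  rw [this]
  exact isOpen_iInter_of_finite fun i => isOpen_Ioo.preimage (by fun_prop)

lemma volume_unitCube_inter_ball_pos (N : ℕ) {r : ℝ} (hr : 0 < r) :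
    0 < volume (unitCube N ∩ Metric.ball 0 r) := by
  refine ((isOpen_unitCube N).inter Metric.isOpen_ball).measure_pos volume ?_
  set w : Euc N := WithLp.toLp 2 fun _ => (1 : ℝ) with hw
  set s : ℝ := min (1 / 2) (r / (‖w‖ + 1)) with hs
  have hs0 : 0 < s := by positivity
  refine ⟨s • w, fun i => ?_, ?_⟩
  · have : s ≤ 1 / 2 := min_le_left _ _
    have h1 : (s • w) i = s := by simp [hw]
    rw [h1]
    exact ⟨hs0, by linarith⟩
  · have : s * (‖w‖ + 1) ≤ r := (le_div_iff₀ (by positivity)).1 (min_le_right _ _)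
    rw [mem_ball_zero_iff, norm_smul, Real.norm_of_nonneg hs0.le]
    nlinarith

lemma eventually_forall_integral_unitCube_le {N : ℕ} {u : ℕ → Euc N → ℝ}
    (hvan : ∀ y : ℕ → Euc N,
      Tendsto (fun k => ∫ x in unitCube N, |u k (x - y k)|) atTop (𝓝 0))
    {ε : ℝ} (hε : 0 < ε) :
    ∀ᶠ k in atTop, ∀ y : Euc N, ∫ x in unitCube N, |u k (x - y)| ≤ ε := by
  have hy : ∀ k, ∃ y : Euc N, (∃ z, ε < ∫ x in unitCube N, |u k (x - z)|) →
      ε < ∫ x in unitCube N, |u k (x - y)| := fun k => by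
    by_cases h : ∃ z, ε < ∫ x in unitCube N, |u k (x - z)|
    · exact ⟨h.choose, fun _ => h.choose_spec⟩
    · exact ⟨0, fun h' => absurd h' h⟩
  choose y hy using hy
  filter_upwards [(hvan y).eventually_lt_const hε] with k hk z
  by_contra! hz
  exact lt_asymm (hy k ⟨z, hz⟩) hk

/-- A function of bounded variation with small mass on all unit cubes has small superlevel sets. -/
lemma mul_volume_superlevel_le {N : ℕ} {u : Euc N → ℝ} (hum : Measurable u) (hu : Integrable u)
    {C : ℝ} (hC : 0 ≤ C) (hTV : TV N u univ ≤ ENNReal.ofReal C) {ε r l : ℝ}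
    (hε : ∀ y : Euc N, ∫ x in unitCube N, |u (x - y)| ≤ ε) {S : Set (Euc N)}
    (hSQ : S ⊆ unitCube N) (hSr : ∀ h ∈ S, ‖h‖ ≤ r) (hSf : volume S ≠ ∞) :
    ENNReal.ofReal (l * volume.real S - ε) * volume {x : Euc N | l < |u x|} ≤
      ENNReal.ofReal (C * r) * volume S := by
  set F : Euc N → Euc N → ℝ≥0∞ := fun x h => ENNReal.ofReal |u (x + h) - u x| with hF
  have hFm : Measurable (Function.uncurry F) := by
    simp only [hF, Function.uncurry_def]
    fun_prop
  have hlow : ∀ x, l < |u x| → ENNReal.ofReal (l * volume.real S - ε) ≤ ∫⁻ h in S, F x h := by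
    intro x hx
    have hi : Integrable (fun h => u (x + h)) := hu.comp_add_left x
    have hconst : ∀ c : ℝ, IntegrableOn (fun _ : Euc N => c) S := fun c => integrableOn_const hSf
    have hdi : IntegrableOn (fun h => |u (x + h) - u x|) S :=
      (hi.integrableOn.sub (hconst _)).abs
    rw [← ofReal_integral_eq_lintegral_ofReal hdi (ae_of_all _ fun _ => abs_nonneg _)]
    refine ENNReal.ofReal_le_ofReal ?_
    have h1 : ∫ h in S, (l - |u (x + h)|) ≤ ∫ h in S, |u (x + h) - u x| := by
      refine integral_mono ((hconst l).sub hi.abs.integrableOn) hdi fun h => ?_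
      have := abs_sub_abs_le_abs_sub (u x) (u (x + h))
      rw [abs_sub_comm] at this
      simp only
      linarith
    rw [integral_sub (hconst l) hi.abs.integrableOn, setIntegral_const] at h1
    have h2 : ∫ h in S, |u (x + h)| ≤ ∫ h in unitCube N, |u (x + h)| :=
      setIntegral_mono_set hi.abs.integrableOn (ae_of_all _ fun _ => abs_nonneg _)
        (LE.le.eventuallyLE hSQ)
    have h3 := hε (-x)
    simp only [sub_neg_eq_add, add_comm _ x] at h3
    simp only [smul_eq_mul, mul_comm _ l] at h1
    linarith
  have hup : ∀ h ∈ S, ∫⁻ x, F x h ≤ ENNReal.ofReal (C * r) := by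
    intro h hh
    have hi : Integrable fun x => |u (x + h) - u x| := ((hu.comp_add_right h).sub hu).abs
    rw [← ofReal_integral_eq_lintegral_ofReal hi (ae_of_all _ fun _ => abs_nonneg _)]
    exact ENNReal.ofReal_le_ofReal ((integral_abs_translate_sub_le hu hC hTV h).trans
      (mul_le_mul_of_nonneg_left (hSr h hh) hC))
  calc _ ≤ ENNReal.ofReal (l * volume.real S - ε) *
        volume {x | ENNReal.ofReal (l * volume.real S - ε) ≤ ∫⁻ h in S, F x h} := by
        gcongr with x
        exact hlow x
    _ ≤ ∫⁻ x, ∫⁻ h in S, F x h := mul_meas_ge_le_lintegral hFm.lintegral_prod_right' _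
    _ = ∫⁻ h in S, ∫⁻ x, F x h := lintegral_lintegral_swap hFm.aemeasurable
    _ ≤ ∫⁻ _ in S, ENNReal.ofReal (C * r) := setLIntegral_mono measurable_const hup
    _ = _ := setLIntegral_const _ _

lemma eventually_volume_superlevel_le {N : ℕ} {u : ℕ → Euc N → ℝ} (hum : ∀ k, Measurable (u k))
    (hu : ∀ k, Integrable (u k)) {C : ℝ} (hC : 0 ≤ C)
    (hTV : ∀ k, TV N (u k) univ ≤ ENNReal.ofReal C)
    (hvan : ∀ y : ℕ → Euc N,
      Tendsto (fun k => ∫ x in unitCube N, |u k (x - y k)|) atTop (𝓝 0))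
    {l t : ℝ} (hl : 0 < l) (ht : 0 < t) :
    ∀ᶠ k in atTop, volume {x : Euc N | l < |u k x|} ≤ ENNReal.ofReal t := by
  set r : ℝ := t * l / (2 * (C + 1)) with hr
  have hr0 : 0 < r := by positivity
  set S : Set (Euc N) := unitCube N ∩ Metric.ball 0 r with hS
  have hSf : volume S ≠ ∞ :=
    ((measure_mono inter_subset_right).trans_lt Metric.isBounded_ball.measure_lt_top).ne
  have hV : 0 < volume.real S := ENNReal.toReal_pos (volume_unitCube_inter_ball_pos N hr0).ne' hSf
  filter_upwards [eventually_forall_integral_unitCube_le hvan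
    (ε := l * volume.real S / 2) (by positivity)] with k hk
  have h := mul_volume_superlevel_le (l := l) (S := S) (hum k) (hu k) hC (hTV k) hk
    inter_subset_left
    (fun h hh => (mem_ball_zero_iff.1 hh.2).le) hSf
  have hpos : 0 < l * volume.real S - l * volume.real S / 2 := by
    rw [_root_.sub_half]
    positivity
  rw [mul_comm, ← ENNReal.le_div_iff_mul_le (Or.inl (by simpa using hpos)) (Or.inl ofReal_ne_top),
    ← ofReal_measureReal hSf, ← ENNReal.ofReal_mul (by positivity),
    ← ENNReal.ofReal_div_of_pos hpos] at h
  refine h.trans (ENNReal.ofReal_le_ofReal ?_)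
  rw [div_le_iff₀ hpos, _root_.sub_half]
  have hCr : C * r ≤ t * l / 2 := by
    rw [hr, mul_div_assoc', div_le_div_iff₀ (by positivity) (by positivity)]
    nlinarith [mul_pos ht hl]
  nlinarith

lemma rearr_nonneg (N : ℕ) (u : Euc N → ℝ) (t : ℝ) : 0 ≤ rearr N u t :=
  Real.sInf_nonneg fun _ h => h.1.le

lemma rearr_le {N : ℕ} {u : Euc N → ℝ} {l t : ℝ} (hl : 0 < l)
    (h : volume {x : Euc N | l < |u x|} ≤ ENNReal.ofReal t) : rearr N u t ≤ l :=
  csInf_le ⟨0, fun _ h => h.1.le⟩ ⟨hl, h⟩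

lemma volume_superlevel_eq_zero {N : ℕ} {u : Euc N → ℝ} {M : ℝ} (hu : ∀ᵐ x, |u x| ≤ M) :
    volume {x : Euc N | M < |u x|} = 0 := by
  simpa [ae_iff] using hu

lemma antitone_rearr {N : ℕ} {u : Euc N → ℝ} {M : ℝ} (hM : 0 < M) (hu : ∀ᵐ x, |u x| ≤ M) :
    Antitone (rearr N u) := fun s t hst =>
  csInf_le_csInf ⟨0, fun _ h => h.1.le⟩ ⟨M, hM, by simp [volume_superlevel_eq_zero hu]⟩
    fun _ h => ⟨h.1, h.2.trans (ENNReal.ofReal_le_ofReal hst)⟩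

lemma rearr_le_div {N : ℕ} {u : Euc N → ℝ} (hu : Integrable u) {C : ℝ} (hC : 0 < C)
    (huC : ∫ x, |u x| ≤ C) {t : ℝ} (ht : 0 < t) : rearr N u t ≤ C / t := by
  have hCt : 0 < C / t := by positivity
  refine rearr_le hCt ?_
  calc volume {x : Euc N | C / t < |u x|}
      ≤ volume {x : Euc N | ENNReal.ofReal (C / t) ≤ ENNReal.ofReal |u x|} :=
        measure_mono fun x hx => ENNReal.ofReal_le_ofReal (le_of_lt hx)
    _ ≤ (∫⁻ x, ENNReal.ofReal |u x|) / ENNReal.ofReal (C / t) :=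
        meas_ge_le_lintegral_div hu.abs.aemeasurable.ennreal_ofReal (by simpa using hCt)
          ofReal_ne_top
    _ ≤ ENNReal.ofReal C / ENNReal.ofReal (C / t) := by
        rw [← ofReal_integral_eq_lintegral_ofReal hu.abs (ae_of_all _ fun _ => abs_nonneg _)]
        gcongr
    _ = ENNReal.ofReal t := by
        rw [← ENNReal.ofReal_div_of_pos hCt]
        congr 1
        field_simp

/-- Convergence to zero in measure together with bounds in `L^1` and `L^∞` implies convergence to
zero in all intermediate Lorentz spaces. -/
lemma tendsto_lorentz_zero {N : ℕ} {p q : ℝ} (hp : 1 < p) (hq : 0 < q) {u : ℕ → Euc N → ℝ}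
    (hu : ∀ k, Integrable (u k)) {M C : ℝ} (hM : 0 < M) (hC : 0 < C)
    (huM : ∀ k, ∀ᵐ x, |u k x| ≤ M) (huC : ∀ k, ∫ x, |u k x| ≤ C)
    (hmeas : ∀ l t : ℝ, 0 < l → 0 < t →
      ∀ᶠ k in atTop, volume {x : Euc N | l < |u k x|} ≤ ENNReal.ofReal t) :
    Tendsto (fun k => lorentz N p (ENNReal.ofReal q) (u k)) atTop (𝓝 0) := by
  simp only [lorentz, ofReal_ne_top, if_false, ENNReal.toReal_ofReal hq.le]
  set F : ℕ → ℝ → ℝ≥0∞ := fun k t =>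
    ENNReal.ofReal ((t ^ (1 / p) * rearr N (u k) t) ^ q / t) with hF
  suffices h : Tendsto (fun k => ∫⁻ t in Ioi (0 : ℝ), F k t) atTop (𝓝 0) by
    have := ((ENNReal.continuous_rpow_const (y := 1 / q)).tendsto 0).comp h
    rwa [ENNReal.zero_rpow_of_pos (by positivity)] at this
  set G : ℝ → ℝ := fun t => (t ^ (1 / p) * min M (C / t)) ^ q / t with hG
  have hmono : ∀ {a b t : ℝ}, 0 < t → 0 ≤ a → a ≤ b →
      (t ^ (1 / p) * a) ^ q / t ≤ (t ^ (1 / p) * b) ^ q / t := by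
    intro a b t ht ha hab
    gcongr
  have hpow : ∀ {t c : ℝ}, 0 < t → 0 ≤ c →
      (t ^ (1 / p) * c) ^ q / t = c ^ q * t ^ (q / p - 1) := by
    intro t c ht hc
    rw [Real.mul_rpow (by positivity) hc, ← Real.rpow_mul ht.le, Real.rpow_sub_one ht.ne',
      one_div_mul_eq_div]
    ring
  have hGm : Measurable G := by fun_prop
  have hG0 : ∀ t, 0 < t → 0 ≤ G t := fun t ht => by
    simp only [hG]
    positivity
  have hG1 : IntegrableOn G (Ioc 0 1) := by
    have h1 : IntegrableOn (fun t : ℝ => M ^ q * t ^ (q / p - 1)) (Ioc 0 1) := by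
      refine Integrable.const_mul ?_ _
      refine (intervalIntegrable_iff_integrableOn_Ioc_of_le zero_le_one).1
        (intervalIntegral.intervalIntegrable_rpow' ?_)
      have : 0 < q / p := by positivity
      linarith
    refine h1.mono' hGm.aestronglyMeasurable ?_
    filter_upwards [ae_restrict_mem measurableSet_Ioc] with t ht
    rw [Real.norm_of_nonneg (hG0 t ht.1), ← hpow ht.1 hM.le]
    have := ht.1
    exact hmono ht.1 (by positivity) (min_le_left _ _)
  have hG2 : IntegrableOn G (Ioi 1) := by
    have h1 : IntegrableOn (fun t : ℝ => C ^ q * t ^ (q / p - q - 1)) (Ioi 1) := by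
      refine Integrable.const_mul (integrableOn_Ioi_rpow_of_lt ?_ one_pos) _
      have : q / p < q := div_lt_self hq hp
      linarith
    refine h1.mono' hGm.aestronglyMeasurable ?_
    filter_upwards [ae_restrict_mem measurableSet_Ioi] with t ht
    have ht0 : 0 < t := one_pos.trans ht
    have h2 : C ^ q * t ^ (q / p - q - 1) = (t ^ (1 / p) * (C / t)) ^ q / t := by
      rw [hpow ht0 (by positivity), Real.div_rpow hC.le ht0.le, sub_right_comm,
        Real.rpow_sub ht0 _ q]
      ring
    rw [Real.norm_of_nonneg (hG0 t ht0), h2]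
    exact hmono ht0 (by positivity) (min_le_right _ _)
  have hGi : IntegrableOn G (Ioi 0) := by
    rw [← Ioc_union_Ioi_eq_Ioi zero_le_one]
    exact hG1.union hG2
  have hlim := tendsto_lintegral_of_dominated_convergence' (μ := volume.restrict (Ioi (0 : ℝ)))
    (F := F) (f := fun _ => 0) (fun t => ENNReal.ofReal (G t)) (fun k => ?_) (fun k => ?_) ?_ ?_
  · simpa using hlim
  · have := (antitone_rearr hM (huM k)).measurable
    exact Measurable.aemeasurable (by fun_prop)
  · filter_upwards [ae_restrict_mem measurableSet_Ioi] with t ht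
    refine ENNReal.ofReal_le_ofReal (hmono ht (rearr_nonneg _ _ _) (le_min ?_ ?_))
    · exact rearr_le hM (by simp [volume_superlevel_eq_zero (huM k)])
    · exact rearr_le_div (hu k) hC (huC k) ht
  · exact hGi.lintegral_lt_top.ne
  · filter_upwards [ae_restrict_mem measurableSet_Ioi] with t ht
    have hr : Tendsto (fun k => rearr N (u k) t) atTop (𝓝 0) := by
      refine tendsto_order.2 ⟨fun a ha => Eventually.of_forall fun k =>
        ha.trans_le (rearr_nonneg _ _ _), fun a ha => ?_⟩
      filter_upwards [hmeas (a / 2) t (half_pos ha) ht] with k hk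
      exact (rearr_le (half_pos ha) hk).trans_lt (half_lt_self ha)
    have h1 : Tendsto (fun k => (t ^ (1 / p) * rearr N (u k) t) ^ q / t) atTop
        (𝓝 ((t ^ (1 / p) * 0) ^ q / t)) :=
      ((hr.const_mul _).rpow_const (Or.inr hq.le)).div_const t
    simpa [hF, Real.zero_rpow hq.ne'] using ENNReal.tendsto_ofReal h1

/-- if `{u_k} ⊂ BV̇(ℝ^N)` is bounded in `L^∞`, `L^1` and in total
variation, and the `L^1`-masses over arbitrarily translated unit cubes vanish,
then `u_k → 0` in `L^{1*,q}(ℝ^N)` for `1 < q ≤ 1*`. -/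
theorem step1_vanishing_lorentz
    (N : ℕ) (hN : 2 ≤ N) (q : ℝ) (hq1 : 1 < q) (hq2 : q ≤ (N : ℝ) / ((N : ℝ) - 1))
    (u : ℕ → Euc N → ℝ) (hmem : ∀ k, MemBVdot N (u k))
    (hLinf : ∃ M : ℝ, ∀ k, ∀ᵐ x : Euc N, |u k x| ≤ M)
    (hL1 : (∀ k, Integrable (u k)) ∧ ∃ C : ℝ, ∀ k, ∫ x, |u k x| ≤ C)
    (hTV : ∃ C : ℝ≥0∞, C ≠ ∞ ∧ ∀ k, TV N (u k) univ ≤ C)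
    (hvan : ∀ y : ℕ → Euc N,
      Tendsto (fun k => ∫ x in unitCube N, |u k (x - y k)|) atTop (𝓝 0)) :
    Tendsto (fun k => lorentz N ((N : ℝ) / ((N : ℝ) - 1)) (ENNReal.ofReal q) (u k))
      atTop (𝓝 0) := by
  obtain ⟨M, hM⟩ := hLinf
  obtain ⟨hint, C, hC⟩ := hL1
  obtain ⟨D, hD, hTV⟩ := hTV
  have hN' : (1 : ℝ) < N := by exact_mod_cast hN
  have hp : 1 < (N : ℝ) / ((N : ℝ) - 1) := by
    rw [one_lt_div (by linarith)]
    linarith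
  refine tendsto_lorentz_zero hp (zero_lt_one.trans hq1) hint (M := max M 1) (C := max C 1)
    (by positivity) (by positivity) (fun k => (hM k).mono fun x hx => hx.trans (le_max_left _ _))
    (fun k => (hC k).trans (le_max_left _ _)) fun l t hl ht => ?_
  exact eventually_volume_superlevel_le (fun k => (hmem k).1) hint toReal_nonneg
    (fun k => (hTV k).trans_eq (ofReal_toReal hD).symm) hvan hl ht
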